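/- Every spectral formal topology is stably compact, and for every spectral formal topology S the patch Patch(S) is a Stone formal topology (i.e. spectral and regular, equivalently spectral with every basic element complemented). -/

import Mathlib

noncomputable section
open Classical

universe u v

namespace FTP

/-! ### Basic covers -/

/-- `U ◁ V` : every element of `U` is covered by `V`. -/
def covS {S : Type*} (cov : S → Set S → Prop) (U V : Set S) : Prop :=
  ∀ a ∈ U, cov a V

/-- A basic cover: reflexivity and transitivity. -/
def IsBasicCover {S : Type*} (cov : S → Set S → Prop) : Prop :=
  (∀ (a : S) (U : Set S), a ∈ U → cov a U) ∧
  (∀ (a : S) (U V : Set S), cov a U → covS cov U V → cov a V)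

/-- the way-below relation `a ≪ b`. -/
def wb {S : Type*} (cov : S → Set S → Prop) (a b : S) : Prop :=
  ∀ U : Set S, cov b U → ∃ U₀ : Finset S, ↑U₀ ⊆ U ∧ cov a ↑U₀

/-- the way-below relation between subsets `U ≪ V`. -/
def wbS {S : Type*} (cov : S → Set S → Prop) (U V : Set S) : Prop :=
  ∀ W : Set S, covS cov V W → ∃ W₀ : Finset S, ↑W₀ ⊆ W ∧ covS cov U ↑W₀

/-- A continuous basic cover, with the witnessing function `w`. -/
def IsContinuous {S : Type*} (cov : S → Set S → Prop) (w : S → Set S) : Prop :=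
  (∀ a : S, ∀ b ∈ w a, wb cov b a) ∧ (∀ a : S, cov a (w a))

/-- splitting subsets. -/
def Splitting {S : Type*} (cov : S → Set S → Prop) (V : Set S) : Prop :=
  ∀ (a : S) (U : Set S), a ∈ V → cov a U → (V ∩ U).Nonempty

/-- located subsets. -/
def Located {S : Type*} (cov : S → Set S → Prop) (V : Set S) : Prop :=
  Splitting cov V ∧ ∀ a b : S, wb cov a b → a ∉ V ∨ b ∈ V

/-- inverse image of a relation. -/
def rinv {α β : Type*} (r : α → β → Prop) (U : Set β) : Set α :=
  {x | ∃ a ∈ U, r x a}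

/-- basic cover maps. -/
def IsBCM {α β : Type*} (cov : α → Set α → Prop) (cov' : β → Set β → Prop)
    (r : α → β → Prop) : Prop :=
  ∀ (a : β) (U : Set β), cov' a U → covS cov (rinv r {a}) (rinv r U)

/-- perfect maps. -/
def IsPerfect {α β : Type*} (cov : α → Set α → Prop) (cov' : β → Set β → Prop)
    (r : α → β → Prop) : Prop :=
  ∀ a b : β, wb cov' a b → wbS cov (rinv r {a}) (rinv r {b})

/-- the terminal basic cover `1 = ({∗}, ∈)`. -/
def unitCov : Unit → Set Unit → Prop := fun x U => x ∈ U

/-! ### Formal topologies -/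

/-- `U ↓ V` with respect to a preorder `le`. -/
def down {S : Type*} (le : S → S → Prop) (U V : Set S) : Set S :=
  {c | ∃ a ∈ U, ∃ b ∈ V, le c a ∧ le c b}

/-- A formal topology: a basic cover together with a compatible preorder. -/
def IsFormalTopology {S : Type*} (cov : S → Set S → Prop) (le : S → S → Prop) : Prop :=
  IsBasicCover cov ∧ Reflexive le ∧ Transitive le ∧
  (∀ a b : S, le a b → cov a {b}) ∧
  (∀ (a : S) (U V : Set S), cov a U → cov a V → cov a (down le U V))

/-- formal topology maps. -/
def IsFTM {α β : Type*} (cov : α → Set α → Prop) (le : α → α → Prop)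
    (cov' : β → Set β → Prop) (le' : β → β → Prop) (r : α → β → Prop) : Prop :=
  IsBCM cov cov' r ∧
  covS cov Set.univ (rinv r Set.univ) ∧
  ∀ a b : β, covS cov (down le (rinv r {a}) (rinv r {b})) (rinv r (down le' {a} {b}))

/-- the order on maps. -/
def MapLE {α β : Type*} (cov : α → Set α → Prop) (r s : α → β → Prop) : Prop :=
  ∀ a : β, covS cov (rinv r {a}) (rinv s {a})

/-- equality of maps. -/
def MapEq {α β : Type*} (cov : α → Set α → Prop) (r s : α → β → Prop) : Prop :=
  MapLE cov r s ∧ MapLE cov s r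

/-- composition of relational maps (`comp s r = s ∘ r`). -/
def comp {α β γ : Type*} (s : β → γ → Prop) (r : α → β → Prop) : α → γ → Prop :=
  fun x c => ∃ b, r x b ∧ s b c

/-- `b* = {c | c ↓ b ◁ ∅}`. -/
def star {S : Type*} (cov : S → Set S → Prop) (le : S → S → Prop) (b : S) : Set S :=
  {c | covS cov (down le {c} {b}) ∅}

/-- `b ⋘ a` iff `S ◁ b* ∪ {a}`. -/
def wc {S : Type*} (cov : S → Set S → Prop) (le : S → S → Prop) (b a : S) : Prop :=
  covS cov Set.univ (star cov le b ∪ {a})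

/-- regular formal topologies. -/
def Regular {S : Type*} (cov : S → Set S → Prop) (le : S → S → Prop) : Prop :=
  ∀ a : S, cov a {b | wc cov le b a}

/-- compactness: `S ≪ S`. -/
def Compact {S : Type*} (cov : S → Set S → Prop) : Prop :=
  wbS cov Set.univ Set.univ

/-- stability: `a ≪ a'` and `b ≪ b'` imply `a↓b ≪ a'↓b'`. -/
def Stable {S : Type*} (cov : S → Set S → Prop) (le : S → S → Prop) : Prop :=
  ∀ a a' b b' : S, wb cov a a' → wb cov b b' →
    wbS cov (down le {a} {b}) (down le {a'} {b'})

/-- isomorphism of formal topologies. -/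
def IsIso {α β : Type*} (cov : α → Set α → Prop) (le : α → α → Prop)
    (cov' : β → Set β → Prop) (le' : β → β → Prop) : Prop :=
  ∃ (r : α → β → Prop) (s : β → α → Prop),
    IsFTM cov le cov' le' r ∧ IsFTM cov' le' cov le s ∧
    MapEq cov (comp s r) (fun a b => a = b) ∧
    MapEq cov' (comp r s) (fun a b => a = b)

/-! ### Geometric theories and the covers they present -/

/-- the preorder `A ≤ B ↔ B ⊆ A` on finite sets of generators. -/
def supord {P : Type*} : Finset P → Finset P → Prop := fun A B => B ⊆ A

/-- The cover on `Finset P` inductively generated by a geometric theory `T`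
(an axiom `T A 𝒞` means `⋀A ⊢ ⋁_{B ∈ 𝒞} ⋀B`). -/
inductive GCov {P : Type*} (T : Finset P → Set (Finset P) → Prop) :
    Finset P → Set (Finset P) → Prop where
  | refl {A : Finset P} {𝒰 : Set (Finset P)} : A ∈ 𝒰 → GCov T A 𝒰
  | le {A B : Finset P} {𝒰 : Set (Finset P)} : B ⊆ A → GCov T B 𝒰 → GCov T A 𝒰
  | ax {A : Finset P} {𝒞 𝒰 : Set (Finset P)} (C : Finset P) :
      T A 𝒞 → (∀ B ∈ 𝒞, GCov T (C ∪ B) 𝒰) → GCov T (C ∪ A) 𝒰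

theorem GCov_trans {P : Type*} {T : Finset P → Set (Finset P) → Prop}
    {A : Finset P} {𝒰 𝒱 : Set (Finset P)}
    (h : GCov T A 𝒰) (h' : ∀ B ∈ 𝒰, GCov T B 𝒱) : GCov T A 𝒱 := by
  induction h with
  | refl hA => exact h' _ hA
  | le hBA _ ih => exact GCov.le hBA (ih h')
  | ax C hT _ ih => exact GCov.ax C hT (fun B hB => ih B hB h')

theorem GCov_isBasicCover {P : Type*} (T : Finset P → Set (Finset P) → Prop) :
    IsBasicCover (GCov T) :=
  ⟨fun _ _ h => GCov.refl h, fun _ _ _ h h' => GCov_trans h h'⟩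

/-! ### The patch, Lawson and lower powerlocale theories -/

/-- generators of the patch/Lawson theories : `r a` and `l A`. -/
inductive PatchGen (S : Type u) : Type u where
  | r : S → PatchGen S
  | l : Finset S → PatchGen S

/-- The geometric theory `T_P` presenting the patch of a stably locally compact
formal topology. -/
inductive PatchThy {S : Type*} (cov : S → Set S → Prop) (le : S → S → Prop) :
    Finset (PatchGen S) → Set (Finset (PatchGen S)) → Prop where
  | R1 : PatchThy cov le ∅ {B | ∃ a : S, B = {PatchGen.r a}}
  | R2 (a b : S) :
      PatchThy cov le {PatchGen.r a, PatchGen.r b}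
        {B | ∃ c ∈ down le {a} {b}, B = {PatchGen.r c}}
  | R3 (a : S) (A : Finset S) :
      cov a ↑A → PatchThy cov le {PatchGen.r a} {B | ∃ b ∈ A, B = {PatchGen.r b}}
  | R4 (a : S) :
      PatchThy cov le {PatchGen.r a} {B | ∃ b : S, wb cov b a ∧ B = {PatchGen.r b}}
  | L1 : PatchThy cov le ∅ {({PatchGen.l ∅} : Finset (PatchGen S))}
  | L2 (A B : Finset S) :
      covS cov ↑A ↑B →
      PatchThy cov le {PatchGen.l B} {({PatchGen.l A} : Finset (PatchGen S))}
  | L3 (A B : Finset S) :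
      PatchThy cov le {PatchGen.l A, PatchGen.l B}
        {D | ∃ C : Finset S, wbS cov ↑A ↑C ∧ wbS cov ↑B ↑C ∧ D = {PatchGen.l C}}
  | Loc (a b : S) :
      wb cov a b →
      PatchThy cov le ∅
        {({PatchGen.l {a}} : Finset (PatchGen S)), ({PatchGen.r b} : Finset (PatchGen S))}
  | D (a : S) :
      PatchThy cov le {PatchGen.l {a}, PatchGen.r a} (∅ : Set (Finset (PatchGen S)))

/-- the cover of `Patch(S)`. -/
def patchCov {S : Type*} (cov : S → Set S → Prop) (le : S → S → Prop) :
    Finset (PatchGen S) → Set (Finset (PatchGen S)) → Prop :=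
  GCov (PatchThy cov le)

/-- the counit `ε_P : Patch(S) → S`. -/
def epsP {S : Type*} (cov : S → Set S → Prop) (le : S → S → Prop) :
    Finset (PatchGen S) → S → Prop :=
  fun 𝔄 a => patchCov cov le 𝔄 {({PatchGen.r a} : Finset (PatchGen S))}

/-- The geometric theory `T_L` presenting the Lawson topology of a continuous
basic cover (the axioms of `T_P` without (R1), (R2)). -/
inductive LawsonThy {S : Type*} (cov : S → Set S → Prop) :
    Finset (PatchGen S) → Set (Finset (PatchGen S)) → Prop where
  | R3 (a : S) (A : Finset S) :
      cov a ↑A → LawsonThy cov {PatchGen.r a} {B | ∃ b ∈ A, B = {PatchGen.r b}}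
  | R4 (a : S) :
      LawsonThy cov {PatchGen.r a} {B | ∃ b : S, wb cov b a ∧ B = {PatchGen.r b}}
  | L1 : LawsonThy cov ∅ {({PatchGen.l ∅} : Finset (PatchGen S))}
  | L2 (A B : Finset S) :
      covS cov ↑A ↑B →
      LawsonThy cov {PatchGen.l B} {({PatchGen.l A} : Finset (PatchGen S))}
  | L3 (A B : Finset S) :
      LawsonThy cov {PatchGen.l A, PatchGen.l B}
        {D | ∃ C : Finset S, wbS cov ↑A ↑C ∧ wbS cov ↑B ↑C ∧ D = {PatchGen.l C}}
  | Loc (a b : S) :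
      wb cov a b →
      LawsonThy cov ∅
        {({PatchGen.l {a}} : Finset (PatchGen S)), ({PatchGen.r b} : Finset (PatchGen S))}
  | D (a : S) :
      LawsonThy cov {PatchGen.l {a}, PatchGen.r a} (∅ : Set (Finset (PatchGen S)))

/-- the cover of the Lawson topology `L(S)`. -/
def lawsonCov {S : Type*} (cov : S → Set S → Prop) :
    Finset (PatchGen S) → Set (Finset (PatchGen S)) → Prop :=
  GCov (LawsonThy cov)

/-- the counit `ε_L : L(S) → S`. -/
def epsL {S : Type*} (cov : S → Set S → Prop) : Finset (PatchGen S) → S → Prop :=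
  fun 𝔄 a => lawsonCov cov 𝔄 {({PatchGen.r a} : Finset (PatchGen S))}

/-- The theory presenting the lower powerlocale of a continuous basic cover:
generators `a ∈ S`, axioms (R3) and (R4). -/
inductive LowerThy {S : Type*} (cov : S → Set S → Prop) :
    Finset S → Set (Finset S) → Prop where
  | R3 (a : S) (A : Finset S) :
      cov a ↑A → LowerThy cov {a} {B | ∃ b ∈ A, B = ({b} : Finset S)}
  | R4 (a : S) :
      LowerThy cov {a} {B | ∃ b : S, wb cov b a ∧ B = ({b} : Finset S)}

/-- the cover of the lower powerlocale `Lower(S)`. -/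
def lowerCov {S : Type*} (cov : S → Set S → Prop) :
    Finset S → Set (Finset S) → Prop :=
  GCov (LowerThy cov)

/-- the counit `σ_L : Lower(S) → S`. -/
def sigmaL {S : Type*} (cov : S → Set S → Prop) : Finset S → S → Prop :=
  fun A a => lowerCov cov A ({({a} : Finset S)} : Set (Finset S))

/-! ### de Groot duals -/

/-- `↟A = {B ∈ Fin S | A ≪ B}`. -/
def upF {S : Type*} (cov : S → Set S → Prop) (A : Finset S) : Set (Finset S) :=
  {B | wbS cov ↑A ↑B}

/-- the finite join `⋁^F {↟A | A ∈ 𝒜}` of Scott open filters. -/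
def finJoin {S : Type*} (cov : S → Set S → Prop) (le : S → S → Prop)
    (𝒜 : Finset (Finset S)) : Set (Finset S) :=
  if 𝒜 = ∅ then {B | covS cov Set.univ ↑B}
  else {B | ∃ g : Finset S → Finset S,
    (∀ A ∈ 𝒜, wbS cov ↑A ↑(g A)) ∧
    wbS cov {c | ∀ A ∈ 𝒜, ∃ b ∈ g A, le c b} ↑B}

/-- The cover `◁^D` of the de Groot dual `S^D`, inductively generated on
`(Fin S, ⊇)` by the axioms (D3) `A ◁ ↟A` and (D4). -/
inductive DCov {S : Type*} (cov : S → Set S → Prop) (le : S → S → Prop) :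
    Finset S → Set (Finset S) → Prop where
  | refl {A : Finset S} {𝒰 : Set (Finset S)} : A ∈ 𝒰 → DCov cov le A 𝒰
  | le {A B : Finset S} {𝒰 : Set (Finset S)} :
      B ⊆ A → DCov cov le B 𝒰 → DCov cov le A 𝒰
  | d3 {A A' : Finset S} {𝒰 : Set (Finset S)} :
      A ⊆ A' →
      (∀ C : Finset S, A' ⊆ C → (∃ B : Finset S, wbS cov ↑A ↑B ∧ B ⊆ C) →
        DCov cov le C 𝒰) →
      DCov cov le A' 𝒰
  | d4 {A A' : Finset S} {𝒜 : Finset (Finset S)} {𝒰 : Set (Finset S)} :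
      A ⊆ A' → upF cov A ⊆ finJoin cov le 𝒜 →
      (∀ C : Finset S, A' ⊆ C → (∃ B ∈ 𝒜, B ⊆ C) → DCov cov le C 𝒰) →
      DCov cov le A' 𝒰

/-- the cover of the Scott topology `Σ(S)` on `(Fin S, ⊇)`. -/
def scottCov {S : Type*} (cov : S → Set S → Prop) :
    Finset S → Set (Finset S) → Prop :=
  fun A 𝒰 => upF cov A ⊆ ⋃ B ∈ 𝒰, upF cov B

/-- a filter (with respect to `◁`) of basic opens, given by a set of finite subsets. -/
def IsCovFilter {S : Type*} (cov : S → Set S → Prop) (le : S → S → Prop)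
    (𝒱 : Set (Finset S)) : Prop :=
  𝒱.Nonempty ∧
  (∀ A ∈ 𝒱, ∀ B : Finset S, covS cov ↑A ↑B → B ∈ 𝒱) ∧
  (∀ A ∈ 𝒱, ∀ B ∈ 𝒱, ∃ C ∈ 𝒱, covS cov ↑C (down le ↑A ↑B))

/-- The geometric theory `T^d` presenting the de Groot dual `S^d`:
generators `l A` (identified with `A : Finset S`), axioms (L1)–(L3) and (D4). -/
inductive DGThy {S : Type*} (cov : S → Set S → Prop) (le : S → S → Prop) :
    Finset (Finset S) → Set (Finset (Finset S)) → Prop where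
  | L1 : DGThy cov le ∅ {({(∅ : Finset S)} : Finset (Finset S))}
  | L2 (A B : Finset S) :
      covS cov ↑A ↑B → DGThy cov le {B} {({A} : Finset (Finset S))}
  | L3 (A B : Finset S) :
      DGThy cov le {A, B}
        {D | ∃ C : Finset S, wbS cov ↑A ↑C ∧ wbS cov ↑B ↑C ∧ D = ({C} : Finset (Finset S))}
  | D4 (A : Finset S) (𝒜 : Finset (Finset S)) :
      upF cov A ⊆ finJoin cov le 𝒜 →
      DGThy cov le {A} {D | ∃ B ∈ 𝒜, D = ({B} : Finset (Finset S))}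

/-! ### Spectral formal topologies -/

/-- spectral formal topologies: a compatible meet-semilattice structure on the
base, with every basic element way-below itself. -/
def IsSpectral {S : Type*} (cov : S → Set S → Prop) (le : S → S → Prop)
    (one : S) (meet : S → S → S) : Prop :=
  (∀ a : S, cov a {one}) ∧
  (∀ a b : S, cov (meet a b) (down le {a} {b})) ∧
  (∀ a b : S, ∀ c ∈ down le {a} {b}, cov c {meet a b}) ∧
  (∀ a : S, wb cov a a)

/-! ### Subtopologies -/

/-- the property of being a formal-topology cover compatible with `le`. -/
def IsFTCover {S : Type*} (cov : S → Set S → Prop) (le : S → S → Prop) : Prop :=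
  IsBasicCover cov ∧ (∀ a b : S, le a b → cov a {b}) ∧
  (∀ (a : S) (U V : Set S), cov a U → cov a V → cov a (down le U V))

/-- The meet (in `SubTop(S)`) of a family of subtopology covers: the least
formal-topology cover containing all of them. -/
def covMeet {S : Type*} {ι : Sort*} (le : S → S → Prop)
    (F : ι → (S → Set S → Prop)) : S → Set S → Prop :=
  fun a U => ∀ c : S → Set S → Prop,
    IsFTCover c le → (∀ i : ι, ∀ (a' : S) (U' : Set S), F i a' U' → c a' U') → c a U

/-- the closed subtopology `C_a` determined by `{a}`. -/
def closedCov {S : Type*} (cov : S → Set S → Prop) (a : S) : S → Set S → Prop :=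
  fun c V => cov c ({a} ∪ V)

/-- the open subtopology `S_B` determined by a finite `B`. -/
def openCov {S : Type*} (cov : S → Set S → Prop) (le : S → S → Prop)
    (B : Finset S) : S → Set S → Prop :=
  fun c V => covS cov (down le {c} ↑B) V

/-- `K_A = ⋀_{A ≪ B} S_B`. -/
def KCov {S : Type*} (cov : S → Set S → Prop) (le : S → S → Prop) (A : Finset S) :
    S → Set S → Prop :=
  covMeet le (fun B : {B : Finset S // wbS cov ↑A ↑B} => openCov cov le B.1)

/-- `C_a ∨ K_A` (the join of subtopologies is the intersection of covers). -/
def CKCov {S : Type*} (cov : S → Set S → Prop) (le : S → S → Prop)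
    (a : S) (A : Finset S) : S → Set S → Prop :=
  fun c V => closedCov cov a c V ∧ KCov cov le A c V

/-- perfect subtopologies. -/
def IsPerfectSub {S : Type*} (cov : S → Set S → Prop) (le : S → S → Prop)
    (cov' : S → Set S → Prop) : Prop :=
  IsFTCover cov' le ∧ (∀ (a : S) (U : Set S), cov a U → cov' a U) ∧
  (∀ a b : S, wb cov a b → wb cov' a b)

/-- the order of `PSub(S)`: `(a,A) ≤ (b,B)` iff `C_b ∨ K_B ⊑ C_a ∨ K_A`. -/
def PSubLe {S : Type*} (cov : S → Set S → Prop) (le : S → S → Prop) :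
    S × Finset S → S × Finset S → Prop :=
  fun p q => ∀ (c : S) (V : Set S), CKCov cov le p.1 p.2 c V → CKCov cov le q.1 q.2 c V

/-- the cover of `PSub(S)`: `(a,A) ◁ U` iff `⋀{C_b ∨ K_B | (b,B) ∈ U} ⊑ C_a ∨ K_A`. -/
def covPSub {S : Type*} (cov : S → Set S → Prop) (le : S → S → Prop) :
    S × Finset S → Set (S × Finset S) → Prop :=
  fun p U => ∀ (c : S) (V : Set S), CKCov cov le p.1 p.2 c V →
    covMeet le (fun q : U => CKCov cov le q.1.1 q.1.2) c V

/-- the map `r : PSub(S) → Patch(S)` on generators. -/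
def rGenPS {S : Type*} (cov : S → Set S → Prop) (le : S → S → Prop)
    (p : S × Finset S) : PatchGen S → Prop
  | PatchGen.r b => covPSub cov le p {((b, (∅ : Finset S)) : S × Finset S)}
  | PatchGen.l B => covPSub cov le p {q : S × Finset S | q.2 = B}

/-- the map `r : PSub(S) → Patch(S)`, extended along the presentation. -/
def rPS {S : Type*} (cov : S → Set S → Prop) (le : S → S → Prop) :
    S × Finset S → Finset (PatchGen S) → Prop :=
  fun p 𝔅 => ∀ g ∈ 𝔅, covPSub cov le p (rinv (fun q g' => rGenPS cov le q g') {g})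

/-- the map `s : Patch(S) → PSub(S)`. -/
def sPS {S : Type*} (cov : S → Set S → Prop) (le : S → S → Prop) :
    Finset (PatchGen S) → (S × Finset S) → Prop :=
  fun 𝔄 p => patchCov cov le 𝔄
    ({({PatchGen.r p.1, PatchGen.l p.2} : Finset (PatchGen S))} : Set (Finset (PatchGen S)))

/-! ### Saturated subsets, dcpos and preframes -/

/-- the saturated subsets of a basic cover. -/
abbrev SatSet {α : Type*} (cov : α → Set α → Prop) : Type _ :=
  {U : Set α // ∀ a, cov a U → a ∈ U}

/-- the join of a family of saturated subsets. -/
def satSup {α : Type*} {cov : α → Set α → Prop} (hbc : IsBasicCover cov)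
    (D : Set (SatSet cov)) : SatSet cov :=
  ⟨{a | cov a (⋃ U ∈ D, (U : Set α))}, fun a h => hbc.2 a _ _ h (fun _ hb => hb)⟩

/-- inductively generated basic covers: `BGen Ax` is the cover generated by the
axiom-set with axioms `a ◁ C` for `C ∈ Ax a`. -/
inductive BGen {S : Type*} (Ax : S → Set (Set S)) : S → Set S → Prop where
  | refl {a : S} {U : Set S} : a ∈ U → BGen Ax a U
  | infty {a : S} {U : Set S} (C : Set S) :
      C ∈ Ax a → (∀ b ∈ C, BGen Ax b U) → BGen Ax a U

theorem BGen_trans {S : Type*} {Ax : S → Set (Set S)} {a : S} {U V : Set S}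
    (h : BGen Ax a U) (h' : ∀ b ∈ U, BGen Ax b V) : BGen Ax a V := by
  induction h with
  | refl ha => exact h' _ ha
  | infty C hC _ ih => exact BGen.infty C hC (fun b hb => ih b hb h')

theorem BGen_isBasicCover {S : Type*} (Ax : S → Set (Set S)) :
    IsBasicCover (BGen Ax) :=
  ⟨fun _ _ h => BGen.refl h, fun _ _ _ h h' => BGen_trans h h'⟩

/-- the lower powerlocale theory of an inductively generated basic cover. -/
inductive LowerThyAx {S : Type*} (Ax : S → Set (Set S)) :
    Finset S → Set (Finset S) → Prop where
  | mk (a : S) (C : Set S) :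
      C ∈ Ax a → LowerThyAx Ax {a} {B | ∃ b ∈ C, B = ({b} : Finset S)}

/-- the counit `σ_L : Lower(S) → S` for an inductively generated basic cover. -/
def sigmaLAx {S : Type*} (Ax : S → Set (Set S)) : Finset S → S → Prop :=
  fun A a => GCov (LowerThyAx Ax) A ({({a} : Finset S)} : Set (Finset S))

/-- the top saturated subset of a presented topology. -/
def satTop {P : Type*} (T : Finset P → Set (Finset P) → Prop) : SatSet (GCov T) :=
  ⟨Set.univ, fun _ _ => Set.mem_univ _⟩

/-- binary meets of saturated subsets of a presented topology. -/
def satInfL {P : Type*} (T : Finset P → Set (Finset P) → Prop)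
    (U V : SatSet (GCov T)) : SatSet (GCov T) :=
  ⟨{A | GCov T A (down supord (U : Set (Finset P)) (V : Set (Finset P)))},
   fun _ h => GCov_trans h (fun _ hB => hB)⟩

/-- the suplattice homomorphism `σ_L* : Sat(S) → Sat(Lower(S))`. -/
def sigmaStar {S : Type*} (Ax : S → Set (Set S)) (U : SatSet (BGen Ax)) :
    SatSet (GCov (LowerThyAx Ax)) :=
  ⟨{A : Finset S | GCov (LowerThyAx Ax) A (rinv (sigmaLAx Ax) (U : Set S))},
   fun _ h => GCov_trans h (fun _ hB => hB)⟩

/-- a preframe structure on a partial order: finite meets and directed joins,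
with finite meets distributing over directed joins. -/
structure PreframeStr (X : Type*) [PartialOrder X] where
  top : X
  inf : X → X → X
  dSup : Set X → X
  le_top : ∀ x, x ≤ top
  inf_le_left : ∀ x y, inf x y ≤ x
  inf_le_right : ∀ x y, inf x y ≤ y
  le_inf : ∀ x y z, x ≤ y → x ≤ z → x ≤ inf y z
  le_dSup : ∀ d : Set X, d.Nonempty → DirectedOn (· ≤ ·) d → ∀ x ∈ d, x ≤ dSup d
  dSup_le : ∀ d : Set X, d.Nonempty → DirectedOn (· ≤ ·) d →
    ∀ z, (∀ x ∈ d, x ≤ z) → dSup d ≤ z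
  distrib : ∀ (x : X) (d : Set X), d.Nonempty → DirectedOn (· ≤ ·) d →
    inf x (dSup d) = dSup ((fun y => inf x y) '' d)

/-- dcpo homomorphisms out of `Sat(S)`. -/
def IsDcpoHom {α : Type*} {cov : α → Set α → Prop} (hbc : IsBasicCover cov)
    {X : Type*} [PartialOrder X] (PF : PreframeStr X) (f : SatSet cov → X) : Prop :=
  Monotone f ∧
  ∀ D : Set (SatSet cov), D.Nonempty → DirectedOn (· ≤ ·) D →
    f (satSup hbc D) = PF.dSup (f '' D)

/-- preframe homomorphisms out of the frame of a presented topology. -/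
def IsPreframeHomL {P : Type*} (T : Finset P → Set (Finset P) → Prop)
    {X : Type*} [PartialOrder X] (PF : PreframeStr X)
    (F : SatSet (GCov T) → X) : Prop :=
  Monotone F ∧ F (satTop T) = PF.top ∧
  (∀ U V, F (satInfL T U V) = PF.inf (F U) (F V)) ∧
  ∀ D : Set (SatSet (GCov T)), D.Nonempty → DirectedOn (· ≤ ·) D →
    F (satSup (GCov_isBasicCover T) D) = PF.dSup (F '' D)

/-! ### Located subsets: auxiliary notions -/

/-- the lower part `L_V` associated to a located subset `V`. -/
def LV {S : Type*} (cov : S → Set S → Prop) (V : Set S) : Set S :=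
  {a | ∃ A : Finset S, wbS cov {a} ↑A ∧ (↑A ∩ V : Set S) = ∅}

/-- cuts of a continuous basic cover. -/
def IsCut {S : Type*} (cov : S → Set S → Prop) (L U : Set S) : Prop :=
  (∀ (a : S) (A : Finset S), cov a ↑A → a ∈ U → ((↑A : Set S) ∩ U).Nonempty) ∧
  (∀ a ∈ U, ∃ b : S, wb cov b a ∧ b ∈ U) ∧
  (∀ (a : S) (A : Finset S), cov a ↑A → (↑A : Set S) ⊆ L → a ∈ L) ∧
  (∀ a ∈ L, ∃ A : Finset S, wbS cov {a} ↑A ∧ (↑A : Set S) ⊆ L) ∧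
  (∀ a b : S, wb cov a b → a ∈ L ∨ b ∈ U) ∧
  L ∩ U = ∅

end FTP

namespace FTP

section GeometricTheories

variable {P : Type*} {T : Finset P → Set (Finset P) → Prop}

theorem GCov.mono {A : Finset P} {𝒰 𝒱 : Set (Finset P)} (h : GCov T A 𝒰) (hUV : 𝒰 ⊆ 𝒱) :
    GCov T A 𝒱 :=
  GCov_trans h fun _ hB => GCov.refl (hUV hB)

/-- Applying an axiom whose premise is already contained in `X`. -/
theorem GCov.of_axiom {A X : Finset P} {𝒞 𝒰 : Set (Finset P)} (hT : T A 𝒞) (hA : A ⊆ X)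
    (h : ∀ B ∈ 𝒞, GCov T (X ∪ B) 𝒰) : GCov T X 𝒰 := by
  have := GCov.ax X hT h
  rwa [Finset.union_eq_left.mpr hA] at this

theorem GCov.union_left {A : Finset P} {𝒰 𝒱 : Set (Finset P)} (h : GCov T A 𝒰) (X : Finset P)
    (h' : ∀ B ∈ 𝒰, GCov T (X ∪ B) 𝒱) : GCov T (X ∪ A) 𝒱 := by
  induction h with
  | refl hA => exact h' _ hA
  | le hBA _ ih => exact GCov.le (Finset.union_subset_union_right hBA) (ih h')
  | ax C hT _ ih =>
    rw [← Finset.union_assoc]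
    refine GCov.ax _ hT fun B hB => ?_
    rw [Finset.union_assoc]
    exact ih B hB h'

theorem mem_star_iff {A B : Finset P} : B ∈ star (GCov T) supord A ↔ GCov T (B ∪ A) ∅ := by
  constructor
  · intro h
    exact h _ ⟨B, rfl, A, rfl, Finset.subset_union_left, Finset.subset_union_right⟩
  · rintro h C ⟨_, rfl, _, rfl, hB, hA⟩
    exact GCov.le (Finset.union_subset hB hA) h

theorem wc_iff {A B : Finset P} :
    wc (GCov T) supord B A ↔ GCov T ∅ (star (GCov T) supord B ∪ {A}) :=
  ⟨fun h => h _ trivial, fun h _ _ => GCov.le (Finset.empty_subset _) h⟩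

/-- A basic element is complemented as soon as its generators are. -/
theorem wc_self_of_generators (h : ∀ g : P, wc (GCov T) supord {g} {g}) (A : Finset P) :
    wc (GCov T) supord A A := by
  induction A using Finset.induction_on with
  | empty => exact wc_iff.mpr (GCov.refl (Or.inr rfl))
  | insert g A _ ih =>
    rw [wc_iff] at ih ⊢
    refine GCov_trans ih ?_
    rintro B (hB | rfl)
    · refine GCov.refl (Or.inl (mem_star_iff.mpr (GCov.le ?_ (mem_star_iff.mp hB))))
      exact Finset.union_subset_union_right (Finset.subset_insert g A)
    · have := (wc_iff.mp (h g)).union_left B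
        (𝒱 := star (GCov T) supord (insert g B) ∪ {insert g B}) ?_
      · simpa using this
      rintro D (hD | rfl)
      · refine GCov.refl (Or.inl (mem_star_iff.mpr (GCov.le ?_ (mem_star_iff.mp hD))))
        intro x
        simp only [Finset.mem_union, Finset.mem_insert, Finset.mem_singleton]
        tauto
      · refine GCov.refl (Or.inr ?_)
        simp

/-- If every axiom can be replaced by one with a finite conclusion, every basic element of the
presented topology is compact. -/
theorem wb_self_of_coherent
    (h : ∀ A 𝒞, T A 𝒞 → ∃ ℱ : Finset (Finset P), ↑ℱ ⊆ 𝒞 ∧ GCov T A ↑ℱ) (A : Finset P) :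
    wb (GCov T) A A := by
  intro 𝒰 hA
  induction hA with
  | @refl A _ hA => exact ⟨{A}, by simpa using hA, GCov.refl (by simp)⟩
  | le hBA _ ih =>
    obtain ⟨𝒰₀, hsub, hcov⟩ := ih
    exact ⟨𝒰₀, hsub, GCov.le hBA hcov⟩
  | ax C hT _ ih =>
    obtain ⟨ℱ, hℱ, hcov⟩ := h _ _ hT
    choose! f hf hf' using ih
    refine ⟨ℱ.biUnion f, ?_, hcov.union_left C fun B hB => (hf' B (hℱ hB)).mono ?_⟩
    · intro D hD
      obtain ⟨B, hB, hD⟩ := Finset.mem_biUnion.mp hD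
      exact hf B (hℱ hB) hD
    · exact Finset.coe_subset.mpr (Finset.subset_biUnion_of_mem f hB)

end GeometricTheories

section BasicCovers

variable {S : Type u} {cov : S → Set S → Prop} {le : S → S → Prop}

theorem covS_finite_subcover (hself : ∀ a, wb cov a a) (hbc : IsBasicCover cov) (A : Finset S)
    {W : Set S} (h : covS cov ↑A W) : ∃ W₀ : Finset S, ↑W₀ ⊆ W ∧ covS cov ↑A ↑W₀ := by
  choose! f hf hf' using fun a (ha : a ∈ A) => hself a W (h a ha)
  refine ⟨A.biUnion f, ?_, fun a ha => ?_⟩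
  · intro c hc
    obtain ⟨a, ha, hc⟩ := Finset.mem_biUnion.mp hc
    exact hf a ha hc
  · exact hbc.2 a _ _ (hf' a ha) fun c hc =>
      hbc.1 _ _ (Finset.mem_coe.mpr (Finset.mem_biUnion.mpr ⟨a, ha, hc⟩))

theorem wbS_of_covS (hself : ∀ a, wb cov a a) (hbc : IsBasicCover cov) (A : Finset S)
    {B : Set S} (h : covS cov ↑A B) : wbS cov ↑A B := fun _ hW =>
  covS_finite_subcover hself hbc A fun a ha => hbc.2 a _ _ (h a ha) hW

theorem covS_of_wbS (hbc : IsBasicCover cov) {A B : Set S} (h : wbS cov A B) :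
    covS cov A B := by
  obtain ⟨W, hW, hA⟩ := h B (fun b hb => hbc.1 b B hb)
  exact fun a ha => hbc.2 a _ _ (hA a ha) fun b hb => hbc.1 _ _ (hW hb)

theorem cov_singleton_of_wb (hbc : IsBasicCover cov) {a b : S} (h : wb cov a b) :
    cov a {b} := by
  obtain ⟨W, hW, ha⟩ := h {b} (hbc.1 b _ rfl)
  exact hbc.2 a _ _ ha fun c hc => hbc.1 _ _ (hW hc)

variable {one : S} {meet : S → S → S}

theorem compact_of_isSpectral (hbc : IsBasicCover cov) (hspec : IsSpectral cov le one meet) :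
    Compact cov := by
  intro W hW
  obtain ⟨W₀, hsub, hone⟩ := hspec.2.2.2 one W (hW one trivial)
  refine ⟨W₀, hsub, fun a _ => hbc.2 a _ _ (hspec.1 a) ?_⟩
  rintro _ rfl
  exact hone

theorem isContinuous_of_isSpectral (hbc : IsBasicCover cov)
    (hspec : IsSpectral cov le one meet) : IsContinuous cov fun a => {a} := by
  refine ⟨?_, fun a => hbc.1 a _ rfl⟩
  rintro a _ rfl
  exact hspec.2.2.2 _

theorem stable_of_isSpectral (hft : IsFormalTopology cov le)
    (hspec : IsSpectral cov le one meet) : Stable cov le := by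
  obtain ⟨hbc, -, -, hle, hdown⟩ := hft
  obtain ⟨-, hmeet, hmeet', hself⟩ := hspec
  intro a a' b b' ha hb W hW
  have h₁ : cov (meet a b) W := by
    refine hbc.2 _ _ _ (hmeet a b) ?_
    rintro c ⟨_, rfl, _, rfl, hca, hcb⟩
    refine hbc.2 _ _ _ (hdown c {a'} {b'} ?_ ?_) hW
    · refine hbc.2 _ _ _ (hle _ _ hca) ?_
      rintro _ rfl
      exact cov_singleton_of_wb hbc ha
    · refine hbc.2 _ _ _ (hle _ _ hcb) ?_
      rintro _ rfl
      exact cov_singleton_of_wb hbc hb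
  obtain ⟨W₀, hsub, hcov⟩ := hself _ _ h₁
  refine ⟨W₀, hsub, fun c hc => hbc.2 _ _ _ (hmeet' a b c hc) ?_⟩
  rintro _ rfl
  exact hcov

end BasicCovers

section Patch

variable {S : Type u} {cov : S → Set S → Prop} {le : S → S → Prop}

theorem patchCov_r {a : S} {A : Finset S} {X : Finset (PatchGen S)}
    {𝒰 : Set (Finset (PatchGen S))} (ha : PatchGen.r a ∈ X) (h : cov a ↑A)
    (h' : ∀ b ∈ A, {PatchGen.r b} ∈ 𝒰) : patchCov cov le X 𝒰 := by
  refine GCov.of_axiom (PatchThy.R3 a A h) (Finset.singleton_subset_iff.mpr ha) ?_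
  rintro _ ⟨b, hb, rfl⟩
  exact GCov.le Finset.subset_union_right (GCov.refl (h' b hb))

theorem patchCov_l {A B : Finset S} {X : Finset (PatchGen S)}
    {𝒰 : Set (Finset (PatchGen S))} (hB : PatchGen.l B ∈ X) (h : covS cov ↑A ↑B)
    (h' : {PatchGen.l A} ∈ 𝒰) : patchCov cov le X 𝒰 := by
  refine GCov.of_axiom (PatchThy.L2 A B h) (Finset.singleton_subset_iff.mpr hB) ?_
  rintro _ rfl
  exact GCov.le Finset.subset_union_right (GCov.refl h')

theorem patchCov_l_union (hbc : IsBasicCover cov) {A B : Finset S} {X : Finset (PatchGen S)}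
    {𝒰 : Set (Finset (PatchGen S))} (hA : PatchGen.l A ∈ X) (hB : PatchGen.l B ∈ X)
    (h' : {PatchGen.l (A ∪ B)} ∈ 𝒰) : patchCov cov le X 𝒰 := by
  refine GCov.of_axiom (PatchThy.L3 A B) (by simp [Finset.insert_subset_iff, hA, hB]) ?_
  rintro _ ⟨C, hAC, hBC, rfl⟩
  refine patchCov_l (B := C) (by simp) (fun c hc => ?_) h'
  rcases Finset.mem_union.mp (Finset.mem_coe.mp hc) with hc | hc
  · exact covS_of_wbS hbc hAC c hc
  · exact covS_of_wbS hbc hBC c hc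

variable {one : S} {meet : S → S → S}

theorem patchThy_coherent (hbc : IsBasicCover cov) (hspec : IsSpectral cov le one meet)
    (A : Finset (PatchGen S)) (𝒞 : Set (Finset (PatchGen S))) (hT : PatchThy cov le A 𝒞) :
    ∃ ℱ : Finset (Finset (PatchGen S)), ↑ℱ ⊆ 𝒞 ∧ patchCov cov le A ↑ℱ := by
  obtain ⟨hone, hmeet, hmeet', hself⟩ := hspec
  have hfin : 𝒞.Finite → ∃ ℱ : Finset (Finset (PatchGen S)), ↑ℱ ⊆ 𝒞 ∧ patchCov cov le A ↑ℱ := by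
    intro hfin
    refine ⟨hfin.toFinset, by simp, ?_⟩
    rw [hfin.coe_toFinset]
    exact GCov.of_axiom hT subset_rfl fun B hB =>
      GCov.le Finset.subset_union_right (GCov.refl hB)
  cases hT with
  | R1 =>
    refine ⟨{{PatchGen.r one}}, by simp, ?_⟩
    refine GCov.of_axiom PatchThy.R1 subset_rfl ?_
    rintro _ ⟨a, rfl⟩
    exact patchCov_r (a := a) (A := {one}) (by simp) (by simpa using hone a) (by simp)
  | R2 a b =>
    obtain ⟨D, hD, hcov⟩ := hself _ _ (hmeet a b)
    refine ⟨D.image fun d => {PatchGen.r d}, ?_, ?_⟩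
    · intro B hB
      obtain ⟨d, hd, rfl⟩ := Finset.mem_image.mp (Finset.mem_coe.mp hB)
      exact ⟨d, hD hd, rfl⟩
    · refine GCov.of_axiom (PatchThy.R2 a b) subset_rfl ?_
      rintro _ ⟨c, hc, rfl⟩
      refine patchCov_r (a := c) (A := D) (by simp) ?_ fun d hd =>
        Finset.mem_coe.mpr (Finset.mem_image_of_mem _ hd)
      refine hbc.2 _ _ _ (hmeet' a b c hc) ?_
      rintro _ rfl
      exact hcov
  | R3 a A h =>
    refine hfin ((A.image fun b => ({PatchGen.r b} : Finset (PatchGen S))).finite_toSet.subset ?_)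
    rintro _ ⟨b, hb, rfl⟩
    exact Finset.mem_coe.mpr (Finset.mem_image_of_mem _ hb)
  | R4 a =>
    refine ⟨{{PatchGen.r a}}, ?_, GCov.refl (by simp)⟩
    simpa using hself a
  | L1 => exact hfin (Set.finite_singleton _)
  | L2 A B h => exact hfin (Set.finite_singleton _)
  | L3 A B =>
    refine ⟨{{PatchGen.l (A ∪ B)}}, ?_,
      patchCov_l_union hbc (A := A) (B := B) (by simp) (by simp) (by simp)⟩
    intro D hD
    refine ⟨A ∪ B, wbS_of_covS hself hbc _ fun a ha => hbc.1 _ _ ?_,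
      wbS_of_covS hself hbc _ fun b hb => hbc.1 _ _ ?_, by simpa using hD⟩
    · exact Finset.mem_coe.mpr (Finset.mem_union_left _ ha)
    · exact Finset.mem_coe.mpr (Finset.mem_union_right _ hb)
  | Loc a b h => exact hfin (by simp)
  | D a => exact hfin Set.finite_empty

theorem isSpectral_patchCov (hbc : IsBasicCover cov) (hspec : IsSpectral cov le one meet) :
    IsSpectral (patchCov cov le) supord (∅ : Finset (PatchGen S)) (· ∪ ·) := by
  refine ⟨fun A => GCov.le (Finset.empty_subset A) (GCov.refl rfl), fun A B => GCov.refl ?_, ?_,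
    wb_self_of_coherent (patchThy_coherent hbc hspec)⟩
  · exact ⟨A, rfl, B, rfl, Finset.subset_union_left, Finset.subset_union_right⟩
  · rintro A B C ⟨_, rfl, _, rfl, hA, hB⟩
    exact GCov.le (Finset.union_subset hA hB) (GCov.refl rfl)

/-- `l A` and the generators `r a` for `a ∈ A` jointly cover the whole space. -/
theorem patchCov_l_or_r (hbc : IsBasicCover cov) (hself : ∀ a, wb cov a a) (A : Finset S) :
    patchCov cov le ∅ ({B | ∃ a ∈ A, B = {PatchGen.r a}} ∪ {{PatchGen.l A}}) := by
  induction A using Finset.induction_on with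
  | empty =>
    refine GCov.of_axiom PatchThy.L1 subset_rfl ?_
    rintro _ rfl
    exact GCov.refl (by simp)
  | insert a A _ ih =>
    refine GCov_trans ih ?_
    rintro _ (⟨b, hb, rfl⟩ | rfl)
    · exact GCov.refl (Or.inl ⟨b, Finset.mem_insert_of_mem hb, rfl⟩)
    · refine GCov.of_axiom (PatchThy.Loc a a (hself a)) (Finset.empty_subset _) ?_
      rintro _ (rfl | rfl)
      · exact patchCov_l_union hbc (A := {a}) (B := A) (by simp) (by simp)
          (Or.inr (by simp))
      · exact GCov.le Finset.subset_union_right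
          (GCov.refl (Or.inl ⟨a, Finset.mem_insert_self a A, rfl⟩))

theorem wc_self_patchGen (hbc : IsBasicCover cov) (hself : ∀ a, wb cov a a) (g : PatchGen S) :
    wc (patchCov cov le) supord {g} {g} := by
  refine wc_iff.mpr ?_
  cases g with
  | r a =>
    refine GCov.of_axiom (PatchThy.Loc a a (hself a)) subset_rfl ?_
    rintro _ (rfl | rfl)
    · refine GCov.le Finset.subset_union_right (GCov.refl (Or.inl (mem_star_iff.mpr ?_)))
      exact GCov.of_axiom (PatchThy.D a) (by simp) (by simp)
    · exact GCov.le Finset.subset_union_right (GCov.refl (Or.inr rfl))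
  | l A =>
    refine GCov.mono (patchCov_l_or_r hbc hself A) ?_
    rintro _ (⟨a, ha, rfl⟩ | rfl)
    · refine Or.inl (mem_star_iff.mpr ?_)
      refine GCov.of_axiom (PatchThy.L2 {a} A fun b hb => hbc.1 _ _ ?_) (by simp) ?_
      · obtain rfl : b = a := by simpa using hb
        exact ha
      · rintro _ rfl
        exact GCov.of_axiom (PatchThy.D a) (by simp [Finset.insert_subset_iff]) (by simp)
    · exact Or.inr rfl

end Patch

/-- Every spectral formal topology is stably compact, and the
patch of a spectral formal topology is Stone (spectral and with every basic
element `𝔄 ⋘ 𝔄`). -/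
theorem spectral_stably_compact_and_patch_stone {S : Type u}
    (cov : S → Set S → Prop) (le : S → S → Prop)
    (hft : IsFormalTopology cov le) (one : S) (meet : S → S → S)
    (hspec : IsSpectral cov le one meet) :
    (Compact cov ∧ (∃ w : S → Set S, IsContinuous cov w) ∧ Stable cov le) ∧
    IsSpectral (patchCov cov le) supord (∅ : Finset (PatchGen S)) (· ∪ ·) ∧
    (∀ 𝔄 : Finset (PatchGen S), wc (patchCov cov le) supord 𝔄 𝔄) := by
  have hbc := hft.1
  exact ⟨⟨compact_of_isSpectral hbc hspec, ⟨_, isContinuous_of_isSpectral hbc hspec⟩,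
    stable_of_isSpectral hft hspec⟩, isSpectral_patchCov hbc hspec,
    wc_self_of_generators (wc_self_patchGen hbc hspec.2.2.2)⟩

end FTP
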